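/- Let α ∈ [0,1], d_max > 0, w_max > 0, and w a nonnegative weight function on keywords. Let Q be a finite set of queries, each q ∈ Q being a pair (q.λ, q.ψ) with q.λ ∈ ℝ² and q.ψ a nonempty finite keyword set. Let N = (Λ_N, Ψ_N) with ∅ ≠ Λ_N ⊆ ℝ² and Ψ_N a finite keyword set, and let o = (o.λ, o.ψ) be an object with o.λ ∈ Λ_N and o.ψ ⊆ Ψ_N. If Σ_{q ∈ Q} cost(q, N) ≥ t for some t ∈ ℝ, then Σ_{q ∈ Q} cost(q, o) ≥ t. -/

import Mathlib

/-- Normalized keyword-set similarity: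
`similarity_key(qψ, Ψ) = (1/|qψ|) · Σ_{y ∈ qψ ∩ Ψ} w(y)/w_max`. -/
noncomputable def simKey {κ : Type*} [DecidableEq κ]
    (qψ Ψ : Finset κ) (w : κ → ℝ) (wmax : ℝ) : ℝ :=
  (1 / (qψ.card : ℝ)) * ∑ y ∈ qψ ∩ Ψ, w y / wmax

/-- Keyword similarity is monotone in the keyword set, for nonnegative weights. -/
theorem simKey_mono {κ : Type*} [DecidableEq κ] {w : κ → ℝ} {wmax : ℝ}
    (hw : ∀ y, 0 ≤ w y) (hwmax : 0 ≤ wmax) (qψ : Finset κ) {Ψ Ψ' : Finset κ} (h : Ψ ⊆ Ψ') :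
    simKey qψ Ψ w wmax ≤ simKey qψ Ψ' w wmax :=
  mul_le_mul_of_nonneg_left
    (Finset.sum_le_sum_of_subset_of_nonneg (Finset.inter_subset_inter_left h)
      fun y _ _ => div_nonneg (hw y) hwmax)
    (by positivity)

/-- Soundness of the GNNK pruning rule (Heuristic 1) for the SUM aggregate:
if the aggregate node cost of `N = (ΛN, ΨN)` over the query group `Q` is at
least `t`, then so is the aggregate cost of any object `o = (oloc, oψ)`
contained in `N`. -/
theorem gnnk_prune_sum
    {ι κ : Type*} [DecidableEq κ]
    (α dmax wmax : ℝ) (hα0 : 0 ≤ α) (hα1 : α ≤ 1)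
    (hd : 0 < dmax) (hwmax : 0 < wmax)
    (w : κ → ℝ) (hw : ∀ y, 0 ≤ w y)
    (Q : Finset ι)
    (loc : ι → EuclideanSpace ℝ (Fin 2)) (kw : ι → Finset κ)
    (hkw : ∀ q ∈ Q, (kw q).Nonempty)
    (ΛN : Set (EuclideanSpace ℝ (Fin 2))) (hΛN : ΛN.Nonempty)
    (ΨN : Finset κ)
    (oloc : EuclideanSpace ℝ (Fin 2)) (oψ : Finset κ)
    (holoc : oloc ∈ ΛN) (hoψ : oψ ⊆ ΨN)
    (t : ℝ)
    (hN : t ≤ ∑ q ∈ Q, (α * Metric.infDist (loc q) ΛN / dmax +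
        (1 - α) * (1 - simKey (kw q) ΨN w wmax))) :
    t ≤ ∑ q ∈ Q, (α * dist (loc q) oloc / dmax +
        (1 - α) * (1 - simKey (kw q) oψ w wmax)) := by
  refine hN.trans (Finset.sum_le_sum fun q _ => add_le_add ?_ ?_)
  · have hdist := Metric.infDist_le_dist_of_mem (x := loc q) holoc
    gcongr
  · have hsim := simKey_mono hw hwmax.le (kw q) hoψ
    exact mul_le_mul_of_nonneg_left (by linarith) (by linarith)
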